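/- arXiv:1711.08001 — 6 statements merged into one kernel-verified Lean document; each statement's English description precedes it below -/
import Mathlib

section
/- Let D be a probability measure on ℝ^d × (Fin k) (pairs of data points and labels), let F : ℝ^d → (Fin k → ℝ) be a model whose output at every point is a probability vector (all coordinates nonnegative and summing to 1), let S ⊆ ℝ^d be a set of allowed perturbations, let L : ℝ^d × (Fin k) → ℝ be a nonnegative loss function, and let τ : ℝ → ℝ satisfy the loss-lower-bound property: for all x ∈ ℝ^d, y ∈ Fin k, and q ∈ [0,1], if F(x)_y ≤ q then L(x, y) ≥ τ(q). Let κ : ℝ^d × (Fin k) → ℝ be a nonnegative integrable (with respect to D) function satisfying κ(x, y) ≥ L(x + Δ, y) for every Δ ∈ S. Fix p ∈ (0,1) with τ(1−p) > 0, and let B be the (measurable) event {(x, y) : ∃ y' ≠ y, ∃ Δ ∈ S, F(x + Δ)_{y'} ≥ p}. If ∫ κ dD ≤ ε, then D(B) ≤ ε / τ(1−p). -/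
open MeasureTheory

/-- Proposition 1 (confident separation), abstract form: under the min-max
adversarial training objective, if the expected worst-case loss is at most `ε`,
then the probability of a `p`-confident wrong prediction in the perturbation
neighborhood is at most `ε / τ (1 - p)`. -/
theorem confident_separation {d k : ℕ}
    (D : Measure ((Fin d → ℝ) × Fin k)) [IsProbabilityMeasure D]
    (F : (Fin d → ℝ) → Fin k → ℝ)
    (hF_nonneg : ∀ x i, 0 ≤ F x i)
    (hF_sum : ∀ x, ∑ i, F x i = 1)
    (S : Set (Fin d → ℝ))
    (L : (Fin d → ℝ) × Fin k → ℝ)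
    (hL_nonneg : ∀ z, 0 ≤ L z)
    (τ : ℝ → ℝ)
    (hτ : ∀ (x : Fin d → ℝ) (y : Fin k) (q : ℝ),
      q ∈ Set.Icc (0 : ℝ) 1 → F x y ≤ q → τ q ≤ L (x, y))
    (κ : (Fin d → ℝ) × Fin k → ℝ)
    (hκ_nonneg : ∀ z, 0 ≤ κ z)
    (hκ_int : Integrable κ D)
    (hκ : ∀ (x : Fin d → ℝ) (y : Fin k), ∀ Δ ∈ S, L (x + Δ, y) ≤ κ (x, y))
    (p ε : ℝ) (hp : p ∈ Set.Ioo (0 : ℝ) 1) (hτp : 0 < τ (1 - p))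
    (B : Set ((Fin d → ℝ) × Fin k))
    (hB : B = {xy | ∃ y' ≠ xy.2, ∃ Δ ∈ S, p ≤ F (xy.1 + Δ) y'})
    (hBmeas : MeasurableSet B)
    (hε : ∫ z, κ z ∂D ≤ ε) :
    D B ≤ ENNReal.ofReal (ε / τ (1 - p)) := by
  have hsub : B ⊆ {z | τ (1 - p) ≤ κ z} := by
    rw [hB]
    rintro ⟨x, y⟩ ⟨y', hne, Δ, hΔ, hpF⟩
    have h1 : F (x + Δ) y' + F (x + Δ) y ≤ 1 := by
      rw [← hF_sum (x + Δ), ← Finset.sum_pair hne]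
      exact Finset.sum_le_sum_of_subset_of_nonneg (Finset.subset_univ _)
        (fun i _ _ => hF_nonneg _ i)
    have h2 : F (x + Δ) y ≤ 1 - p := by
      dsimp only at hpF
      linarith
    exact (hτ _ _ _ ⟨by linarith [hp.2], by linarith [hp.1]⟩ h2).trans (hκ x y Δ hΔ)
  have hm := mul_meas_ge_le_integral_of_nonneg
    (Filter.Eventually.of_forall hκ_nonneg) hκ_int (τ (1 - p))
  have h3 : D.real B ≤ ε / τ (1 - p) := by
    rw [le_div_iff₀ hτp]
    have h4 : D.real B ≤ D.real {z | τ (1 - p) ≤ κ z} := measureReal_mono hsub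
    nlinarith
  rw [← ofReal_measureReal]
  exact ENNReal.ofReal_le_ofReal h3
end

section
/- Let D be a probability measure on ℝ^d × (Fin k), let F : ℝ^d → (Fin k → ℝ) be a model whose output at every point is a probability vector, fix δ ≥ 0 and let S = {Δ ∈ ℝ^d : ‖Δ‖ ≤ δ} be the closed δ-ball around the origin with respect to a norm ‖·‖ on ℝ^d. Let L : ℝ^d × (Fin k) → ℝ be a nonnegative loss, τ : ℝ → ℝ a loss-lower-bound function for L (i.e., F(x)_y ≤ q implies L(x,y) ≥ τ(q)), and κ : ℝ^d × (Fin k) → ℝ a nonnegative integrable function with κ(x,y) ≥ L(x+Δ, y) for all Δ ∈ S. Fix p ∈ (0,1) with τ(1−p) > 0. If ∫ κ dD ≤ ε, then F satisfies (p, ε/τ(1−p), δ)-separation: the D-probability of the event {(x,y) : ∃ y' ≠ y, ∃ x' with ‖x' − x‖ ≤ δ, F(x')_{y'} ≥ p} is at most ε/τ(1−p). -/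
open MeasureTheory

/-- Corollary of Proposition 1: with perturbation set the closed `δ`-ball of a
norm `N` on `ℝ^d`, a model with adversarial training objective at most `ε`
satisfies `(p, ε / τ (1 - p), δ)`-separation. -/
theorem separation_from_min_max {d k : ℕ}
    (N : Seminorm ℝ (Fin d → ℝ)) (hN : ∀ x, N x = 0 → x = 0)
    (D : Measure ((Fin d → ℝ) × Fin k)) [IsProbabilityMeasure D]
    (F : (Fin d → ℝ) → Fin k → ℝ)
    (hF_nonneg : ∀ x i, 0 ≤ F x i)
    (hF_sum : ∀ x, ∑ i, F x i = 1)
    (δ : ℝ) (hδ : 0 ≤ δ)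
    (L : (Fin d → ℝ) × Fin k → ℝ)
    (hL_nonneg : ∀ z, 0 ≤ L z)
    (τ : ℝ → ℝ)
    (hτ : ∀ (x : Fin d → ℝ) (y : Fin k) (q : ℝ),
      q ∈ Set.Icc (0 : ℝ) 1 → F x y ≤ q → τ q ≤ L (x, y))
    (κ : (Fin d → ℝ) × Fin k → ℝ)
    (hκ_nonneg : ∀ z, 0 ≤ κ z)
    (hκ_int : Integrable κ D)
    (hκ : ∀ (x : Fin d → ℝ) (y : Fin k), ∀ Δ : Fin d → ℝ,
      N Δ ≤ δ → L (x + Δ, y) ≤ κ (x, y))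
    (p ε : ℝ) (hp : p ∈ Set.Ioo (0 : ℝ) 1) (hτp : 0 < τ (1 - p))
    (B : Set ((Fin d → ℝ) × Fin k))
    (hB : B = {xy | ∃ y' ≠ xy.2, ∃ x' : Fin d → ℝ, N (x' - xy.1) ≤ δ ∧ p ≤ F x' y'})
    (hBmeas : MeasurableSet B)
    (hε : ∫ z, κ z ∂D ≤ ε) :
    D B ≤ ENNReal.ofReal (ε / τ (1 - p)) := by
  have hsub : B ⊆ {z | τ (1 - p) ≤ κ z} := by
    rw [hB]
    rintro ⟨x, y⟩ ⟨y', hne, x', hx', hpF⟩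
    simp only at hne hx'
    have h2 : F x' y' + F x' y ≤ 1 := by
      rw [← hF_sum x', ← Finset.sum_pair hne]
      exact Finset.sum_le_sum_of_subset_of_nonneg (Finset.subset_univ _)
        (fun i _ _ => hF_nonneg x' i)
    have h3 := hτ x' y (1 - p) ⟨by linarith [hp.2], by linarith [hp.1]⟩ (by linarith)
    have h4 := hκ x y (x' - x) hx'
    rw [add_sub_cancel] at h4
    exact h3.trans h4
  have hm := mul_meas_ge_le_integral_of_nonneg
    (Filter.Eventually.of_forall hκ_nonneg) hκ_int (τ (1 - p))
  refine (measure_mono hsub).trans ?_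
  rw [← ofReal_measureReal]
  apply ENNReal.ofReal_le_ofReal
  rw [le_div_iff₀ hτp, mul_comm]
  exact hm.trans hε
end

section
/- Let D be a probability measure on ℝ^d × (Fin k), let F : ℝ^d → (Fin k → ℝ) be a model whose output at every point is a probability vector with all coordinates strictly positive, let S ⊆ ℝ^d be a set of perturbations, and let L be the cross-entropy loss L(x, y) = −log F(x)_y. Let κ : ℝ^d × (Fin k) → ℝ be a nonnegative integrable function with κ(x,y) ≥ L(x+Δ, y) for all Δ ∈ S. Fix p ∈ (0,1). If ∫ κ dD ≤ ε, then the D-probability of the event {(x,y) : ∃ y' ≠ y, ∃ Δ ∈ S, F(x + Δ)_{y'} ≥ p} is at most −ε / log(1−p). -/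
open MeasureTheory

/-- Proposition 1 instantiated with the cross-entropy loss
`L(x, y) = -log F(x)_y`: the probability of a `p`-confident wrong prediction in
the perturbation neighborhood is at most `-ε / log (1 - p)`. -/
theorem confident_separation_cross_entropy {d k : ℕ}
    (D : Measure ((Fin d → ℝ) × Fin k)) [IsProbabilityMeasure D]
    (F : (Fin d → ℝ) → Fin k → ℝ)
    (hF_pos : ∀ x i, 0 < F x i)
    (hF_sum : ∀ x, ∑ i, F x i = 1)
    (S : Set (Fin d → ℝ))
    (κ : (Fin d → ℝ) × Fin k → ℝ)
    (hκ_nonneg : ∀ z, 0 ≤ κ z)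
    (hκ_int : Integrable κ D)
    (hκ : ∀ (x : Fin d → ℝ) (y : Fin k), ∀ Δ ∈ S,
      -Real.log (F (x + Δ) y) ≤ κ (x, y))
    (p ε : ℝ) (hp : p ∈ Set.Ioo (0 : ℝ) 1)
    (B : Set ((Fin d → ℝ) × Fin k))
    (hB : B = {xy | ∃ y' ≠ xy.2, ∃ Δ ∈ S, p ≤ F (xy.1 + Δ) y'})
    (hBmeas : MeasurableSet B)
    (hε : ∫ z, κ z ∂D ≤ ε) :
    D B ≤ ENNReal.ofReal (-ε / Real.log (1 - p)) := by
  obtain ⟨hp0, hp1⟩ := hp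
  have hlog : Real.log (1 - p) < 0 := Real.log_neg (by linarith) (by linarith)
  have hsub : B ⊆ {z | -Real.log (1 - p) ≤ κ z} := by
    rw [hB]
    rintro ⟨x, y⟩ ⟨y', hne, Δ, hΔ, hpF⟩
    have h1 : F (x + Δ) y + F (x + Δ) y' ≤ 1 := by
      rw [← hF_sum (x + Δ), ← Finset.sum_pair (Ne.symm hne)]
      exact Finset.sum_le_sum_of_subset_of_nonneg (Finset.subset_univ _)
        (fun i _ _ => (hF_pos _ i).le)
    have h2 : Real.log (F (x + Δ) y) ≤ Real.log (1 - p) :=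
      Real.log_le_log (hF_pos _ _) (by simp only at hpF; linarith)
    have h3 := hκ x y Δ hΔ
    show -Real.log (1 - p) ≤ κ (x, y)
    linarith
  have hM := mul_meas_ge_le_integral_of_nonneg (μ := D)
    (Filter.Eventually.of_forall hκ_nonneg) hκ_int (-Real.log (1 - p))
  refine (measure_mono hsub).trans ?_
  rw [← ENNReal.ofReal_toReal (measure_ne_top D {z | -Real.log (1 - p) ≤ κ z})]
  apply ENNReal.ofReal_le_ofReal
  rw [neg_div, ← div_neg, le_div_iff₀ (by linarith), mul_comm]
  exact hM.trans hε
end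

section
/- Let D be a probability measure on ℝ^d × (Fin k), let F : ℝ^d → (Fin k → ℝ) be a model whose output at every point is a probability vector, let S ⊆ ℝ^d be a set of perturbations, and let L be the squared loss L(x, y) = (1 − F(x)_y)². Let κ : ℝ^d × (Fin k) → ℝ be a nonnegative integrable function with κ(x,y) ≥ L(x+Δ, y) for all Δ ∈ S. Fix p ∈ (0,1). If ∫ κ dD ≤ ε, then the D-probability of the event {(x,y) : ∃ y' ≠ y, ∃ Δ ∈ S, F(x + Δ)_{y'} ≥ p} is at most ε / p². -/
open MeasureTheory

/-- Proposition 1 instantiated with the squared loss `L(x, y) = (1 - F(x)_y)²`: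
the probability of a `p`-confident wrong prediction in the perturbation
neighborhood is at most `ε / p²`. -/
theorem confident_separation_squared_loss {d k : ℕ}
    (D : Measure ((Fin d → ℝ) × Fin k)) [IsProbabilityMeasure D]
    (F : (Fin d → ℝ) → Fin k → ℝ)
    (hF_nonneg : ∀ x i, 0 ≤ F x i)
    (hF_sum : ∀ x, ∑ i, F x i = 1)
    (S : Set (Fin d → ℝ))
    (κ : (Fin d → ℝ) × Fin k → ℝ)
    (hκ_nonneg : ∀ z, 0 ≤ κ z)
    (hκ_int : Integrable κ D)
    (hκ : ∀ (x : Fin d → ℝ) (y : Fin k), ∀ Δ ∈ S,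
      (1 - F (x + Δ) y) ^ 2 ≤ κ (x, y))
    (p ε : ℝ) (hp : p ∈ Set.Ioo (0 : ℝ) 1)
    (B : Set ((Fin d → ℝ) × Fin k))
    (hB : B = {xy | ∃ y' ≠ xy.2, ∃ Δ ∈ S, p ≤ F (xy.1 + Δ) y'})
    (hBmeas : MeasurableSet B)
    (hε : ∫ z, κ z ∂D ≤ ε) :
    D B ≤ ENNReal.ofReal (ε / p ^ 2) := by
  obtain ⟨hp0, _⟩ := hp
  have hp2 : 0 < p ^ 2 := by positivity
  have hsub : B ⊆ {z | p ^ 2 ≤ κ z} := by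
    rw [hB]
    rintro ⟨x, y⟩ ⟨y', hne, Δ, hΔ, hle⟩
    have h1 := hκ x y Δ hΔ
    have h2 : F (x + Δ) y' + F (x + Δ) y ≤ 1 := by
      rw [← hF_sum (x + Δ), ← Finset.sum_pair hne]
      exact Finset.sum_le_sum_of_subset_of_nonneg (Finset.subset_univ _)
        (fun i _ _ => hF_nonneg _ i)
    have h3 : p ^ 2 ≤ (1 - F (x + Δ) y) ^ 2 :=
      pow_le_pow_left₀ hp0.le (by linarith) 2
    exact h3.trans h1
  have hm := mul_meas_ge_le_integral_of_nonneg
    (Filter.Eventually.of_forall hκ_nonneg) hκ_int (p ^ 2)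
  have hreal : D.real {z | p ^ 2 ≤ κ z} ≤ ε / p ^ 2 := by
    rw [le_div_iff₀ hp2, mul_comm]
    exact hm.trans hε
  calc D B ≤ D {z | p ^ 2 ≤ κ z} := measure_mono hsub
    _ = ENNReal.ofReal (D.real {z | p ^ 2 ≤ κ z}) := (ofReal_measureReal).symm
    _ ≤ _ := ENNReal.ofReal_le_ofReal hreal
end

section
/- Let D be a probability measure on ℝ^d × (Fin k), let F : ℝ^d → (Fin k → ℝ) be a model whose output at every point is a probability vector, let S ⊆ ℝ^d be a set of perturbations containing 0, let L : ℝ^d × (Fin k) → ℝ be a nonnegative loss with loss-lower-bound function τ : ℝ → ℝ (i.e., F(x)_y ≤ q implies L(x,y) ≥ τ(q)), and let κ : ℝ^d × (Fin k) → ℝ be a nonnegative integrable function with κ(x,y) ≥ L(x+Δ, y) for all Δ ∈ S. Assume τ(1/2) > 0. If ∫ κ dD ≤ ε, then the D-probability of the event {(x,y) : ∃ y' ≠ y, ∃ Δ ∈ S, the classification C_F(x+Δ) equals y'} is at most ε / τ(1/2), where C_F(x') = y' means F(x')_{y'} > F(x')_{y''} for every y'' ≠ y' (the model strictly prefers label y'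 at x'). -/
open MeasureTheory

/-- Proposition 2 (unconfident separation): if the expected worst-case loss is
at most `ε`, then the probability that some perturbation in `S` yields a wrong
classification (the model strictly prefers a wrong label) is at most
`ε / τ (1/2)`. -/
theorem unconfident_separation {d k : ℕ}
    (D : Measure ((Fin d → ℝ) × Fin k)) [IsProbabilityMeasure D]
    (F : (Fin d → ℝ) → Fin k → ℝ)
    (hF_nonneg : ∀ x i, 0 ≤ F x i)
    (hF_sum : ∀ x, ∑ i, F x i = 1)
    (S : Set (Fin d → ℝ)) (hS0 : (0 : Fin d → ℝ) ∈ S)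
    (L : (Fin d → ℝ) × Fin k → ℝ)
    (hL_nonneg : ∀ z, 0 ≤ L z)
    (τ : ℝ → ℝ)
    (hτ : ∀ (x : Fin d → ℝ) (y : Fin k) (q : ℝ),
      q ∈ Set.Icc (0 : ℝ) 1 → F x y ≤ q → τ q ≤ L (x, y))
    (hτ_half : 0 < τ (1 / 2))
    (κ : (Fin d → ℝ) × Fin k → ℝ)
    (hκ_nonneg : ∀ z, 0 ≤ κ z)
    (hκ_int : Integrable κ D)
    (hκ : ∀ (x : Fin d → ℝ) (y : Fin k), ∀ Δ ∈ S, L (x + Δ, y) ≤ κ (x, y))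
    (ε : ℝ)
    (B : Set ((Fin d → ℝ) × Fin k))
    (hB : B = {xy | ∃ y' ≠ xy.2, ∃ Δ ∈ S,
      ∀ y'' ≠ y', F (xy.1 + Δ) y'' < F (xy.1 + Δ) y'})
    (hBmeas : MeasurableSet B)
    (hε : ∫ z, κ z ∂D ≤ ε) :
    D B ≤ ENNReal.ofReal (ε / τ (1 / 2)) := by
  have hsub : B ⊆ {z | τ (1 / 2) ≤ κ z} := by
    rw [hB]
    rintro ⟨x, y⟩ ⟨y', hy', Δ, hΔ, h⟩
    have h1 : F (x + Δ) y < F (x + Δ) y' := h y (Ne.symm hy')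
    have h2 : F (x + Δ) y' + F (x + Δ) y ≤ 1 := by
      rw [← hF_sum (x + Δ), ← Finset.sum_pair hy']
      exact Finset.sum_le_sum_of_subset_of_nonneg (Finset.subset_univ _)
        (fun i _ _ => hF_nonneg _ i)
    have h3 : τ (1 / 2) ≤ L (x + Δ, y) :=
      hτ (x + Δ) y (1 / 2) ⟨by norm_num, by norm_num⟩ (by linarith)
    exact h3.trans (hκ x y Δ hΔ)
  have hm := mul_meas_ge_le_integral_of_nonneg
    (Filter.Eventually.of_forall hκ_nonneg) hκ_int (τ (1 / 2))
  have hr : D.real B ≤ ε / τ (1 / 2) := by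
    rw [le_div_iff₀ hτ_half, mul_comm]
    exact ((mul_le_mul_of_nonneg_left (measureReal_mono hsub) hτ_half.le).trans hm).trans hε
  rw [← ofReal_measureReal (μ := D) (s := B)]
  exact ENNReal.ofReal_le_ofReal hr
end

section
/- Let D be a probability measure on ℝ^d × (Fin k), let F : ℝ^d → (Fin k → ℝ) be a model whose output at every point is a probability vector with strictly positive coordinates, let S ⊆ ℝ^d be a set of perturbations, let L be the cross-entropy loss L(x,y) = −log F(x)_y, and let κ : ℝ^d × (Fin k) → ℝ be a nonnegative integrable function with κ(x,y) ≥ L(x+Δ, y) for all Δ ∈ S. If ∫ κ dD ≤ ε, then the D-probability of the event {(x,y) : ∃ y' ≠ y, ∃ Δ ∈ S, F(x+Δ)_{y'} > F(x+Δ)_{y''} for all y'' ≠ y'} is at most ε / log 2. -/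
open MeasureTheory

/-- Proposition 2 instantiated with the cross-entropy loss
`L(x, y) = -log F(x)_y`: the probability that some perturbation in `S` yields a
wrong classification is at most `ε / log 2`. -/
theorem unconfident_separation_cross_entropy {d k : ℕ}
    (D : Measure ((Fin d → ℝ) × Fin k)) [IsProbabilityMeasure D]
    (F : (Fin d → ℝ) → Fin k → ℝ)
    (hF_pos : ∀ x i, 0 < F x i)
    (hF_sum : ∀ x, ∑ i, F x i = 1)
    (S : Set (Fin d → ℝ))
    (κ : (Fin d → ℝ) × Fin k → ℝ)
    (hκ_nonneg : ∀ z, 0 ≤ κ z)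
    (hκ_int : Integrable κ D)
    (hκ : ∀ (x : Fin d → ℝ) (y : Fin k), ∀ Δ ∈ S,
      -Real.log (F (x + Δ) y) ≤ κ (x, y))
    (ε : ℝ)
    (B : Set ((Fin d → ℝ) × Fin k))
    (hB : B = {xy | ∃ y' ≠ xy.2, ∃ Δ ∈ S,
      ∀ y'' ≠ y', F (xy.1 + Δ) y'' < F (xy.1 + Δ) y'})
    (hBmeas : MeasurableSet B)
    (hε : ∫ z, κ z ∂D ≤ ε) :
    D B ≤ ENNReal.ofReal (ε / Real.log 2) := by
  have hlog : 0 < Real.log 2 := Real.log_pos (by norm_num)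
  have hsub : B ⊆ {z | Real.log 2 ≤ κ z} := by
    rw [hB]
    rintro ⟨x, y⟩ ⟨y', hne, Δ, hΔ, hmax⟩
    have h1 := hmax y (Ne.symm hne)
    have h2 : F (x + Δ) y' + F (x + Δ) y ≤ 1 := by
      rw [← hF_sum (x + Δ), ← Finset.sum_pair hne]
      exact Finset.sum_le_sum_of_subset_of_nonneg (Finset.subset_univ _)
        (fun i _ _ => (hF_pos _ i).le)
    have h3 : F (x + Δ) y ≤ 2⁻¹ := by
      simp only at h1
      linarith
    have h4 := Real.log_le_log (hF_pos (x + Δ) y) h3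
    rw [Real.log_inv] at h4
    have h5 := hκ x y Δ hΔ
    show Real.log 2 ≤ κ (x, y)
    linarith
  have hmk := mul_meas_ge_le_integral_of_nonneg
    (Filter.Eventually.of_forall hκ_nonneg) hκ_int (Real.log 2)
  have hle : D.real {z | Real.log 2 ≤ κ z} ≤ ε / Real.log 2 := by
    rw [le_div_iff₀ hlog, mul_comm]
    exact hmk.trans hε
  calc D B ≤ D {z | Real.log 2 ≤ κ z} := measure_mono hsub
    _ = ENNReal.ofReal (D.real {z | Real.log 2 ≤ κ z}) := by
      rw [ofReal_measureReal]
    _ ≤ _ := ENNReal.ofReal_le_ofReal hle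
end
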